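/- Let W be a confocal linear family of bisectors whose common focus is not negative: there is a nonzero f₀ ∈ V with ⟨f₀,f₀⟩ ≥ 0 and h f₀ = 0 for all h ∈ W. Then dim_ℝ W ≤ 2. -/

import Mathlib

open scoped ComplexConjugate

noncomputable section

/-- `V` is `ℂ³`. -/
abbrev V3 : Type := Fin 3 → ℂ

/-- The hermitian form of signature `(2,1)`:
`⟨x,y⟩ = x₀·conj y₀ + x₁·conj y₁ − x₂·conj y₂`. -/
def herm (x y : V3) : ℂ := x 0 * conj (y 0) + x 1 * conj (y 1) - x 2 * conj (y 2)

/-- The complex projective plane `ℙ(V)`. -/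
abbrev PV : Type := Projectivization ℂ V3

/-- The class `[v]` of a nonzero vector `v` in `ℙ(V)`. -/
def projMk (v : V3) (hv : v ≠ 0) : PV := Projectivization.mk ℂ v hv

/-- A map `h` is self-adjoint (`h* = h`) w.r.t. the hermitian form. -/
def SelfAdj (h : Module.End ℂ V3) : Prop := ∀ x y : V3, herm (h x) y = herm x (h y)

/-- The set `B_h = {[v] ∈ ℙ(V) | ⟨h v, v⟩ = 0}`. -/
def Bset (h : Module.End ℂ V3) : Set PV :=
  {q | ∃ v : V3, ∃ hv : v ≠ 0, q = projMk v hv ∧ herm (h v) v = 0}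

/-- `h` defines a bisector: self-adjoint, trace `0`, rank `2`, and `B_h` contains
a point other than the focus (i.e. a point `[v]` with `h v ≠ 0`). -/
def IsBisector (h : Module.End ℂ V3) : Prop :=
  SelfAdj h ∧ LinearMap.trace ℂ V3 h = 0 ∧
    Module.finrank ℂ (LinearMap.range h) = 2 ∧ ∃ v : V3, herm (h v) v = 0 ∧ h v ≠ 0

/-- A linear family of bisectors: an `ℝ`-subspace of self-adjoint traceless
degenerate maps whose base contains a negative point. -/
def IsLinearFamily (W : Submodule ℝ (Module.End ℂ V3)) : Prop :=
  (∀ h ∈ W, SelfAdj h ∧ LinearMap.trace ℂ V3 h = 0 ∧ LinearMap.det h = 0) ∧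
    ∃ v : V3, ∃ hv : v ≠ 0, (herm v v).re < 0 ∧ ∀ h ∈ W, herm (h v) v = 0

/-- The map `x ↦ ⟨x,p⟩·p`. -/
def wmap (p : V3) : Module.End ℂ V3 where
  toFun x := herm x p • p
  map_add' x y := by
    show herm (x + y) p • p = herm x p • p + herm y p • p
    have : herm (x + y) p = herm x p + herm y p := by
      simp only [herm, Pi.add_apply]; ring
    rw [this, add_smul]
  map_smul' c x := by
    show herm (c • x) p • p = c • (herm x p • p)
    have : herm (c • x) p = c * herm x p := by
      simp only [herm, Pi.smul_apply, smul_eq_mul]; ring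
    rw [this, mul_smul]

/-- `ℙ(U)` for a complex subspace `U`. -/
def projC (U : Submodule ℂ V3) : Set PV :=
  {q | ∃ v : V3, ∃ hv : v ≠ 0, v ∈ U ∧ q = projMk v hv}

/-- `ℙ(T)` for a real subspace `T`. -/
def projR (T : Submodule ℝ V3) : Set PV :=
  {q | ∃ v : V3, ∃ hv : v ≠ 0, v ∈ T ∧ q = projMk v hv}

/-- An `ℝ`-plane: `ℙ(T)` for a totally real `3`-dimensional real subspace `T`
with `ℂ·T = V`. -/
def IsRealPlane (T : Submodule ℝ V3) : Prop :=
  Module.finrank ℝ T = 3 ∧ Submodule.span ℂ (T : Set V3) = ⊤ ∧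
    ∀ t ∈ T, ∀ t' ∈ T, (herm t t').im = 0

/-- A geodesic: `ℙ(W₀)` for a `2`-dimensional real subspace `W₀` on which the form
is real-valued and not identically zero. -/
def IsGeodesic (W₀ : Submodule ℝ V3) : Prop :=
  Module.finrank ℝ W₀ = 2 ∧ (∀ w ∈ W₀, ∀ w' ∈ W₀, (herm w w').im = 0) ∧
    ∃ w ∈ W₀, ∃ w' ∈ W₀, herm w w' ≠ 0

/-- The real spine `R = {[h v] | [v] ∈ B_h, h v ≠ 0}` of `B_h`. -/
def RealSpine (h : Module.End ℂ V3) : Set PV :=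
  {q | ∃ v : V3, ∃ hnz : h v ≠ 0, herm (h v) v = 0 ∧ q = projMk (h v) hnz}

/-- The orthogonal complement w.r.t. the hermitian form. -/
def hermOrth (U : Submodule ℂ V3) : Submodule ℂ V3 where
  carrier := {x | ∀ u ∈ U, herm x u = 0}
  add_mem' := by
    intro a b ha hb u hu
    have h1 : herm (a + b) u = herm a u + herm b u := by
      simp only [herm, Pi.add_apply]; ring
    rw [h1, ha u hu, hb u hu, add_zero]
  zero_mem' := by
    intro u hu
    simp [herm]
  smul_mem' := by
    intro c x hx u hu
    have h1 : herm (c • x) u = c * herm x u := by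
      simp only [herm, Pi.smul_apply, smul_eq_mul]; ring
    rw [h1, hx u hu, mul_zero]


theorem herm_add_left (x y z : V3) : herm (x + y) z = herm x z + herm y z := by
  simp only [herm, Pi.add_apply]; ring

theorem herm_smul_left (c : ℂ) (x y : V3) : herm (c • x) y = c * herm x y := by
  simp only [herm, Pi.smul_apply, smul_eq_mul]; ring

theorem herm_conj_symm (x y : V3) : conj (herm x y) = herm y x := by
  simp only [herm, map_add, map_sub, map_mul, Complex.conj_conj]; ring

theorem herm_zero_left (y : V3) : herm 0 y = 0 := by simp [herm]

theorem herm_zero_right (x : V3) : herm x 0 = 0 := by simp [herm]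

theorem herm_self_re (x : V3) :
    (herm x x).re = ‖x 0‖ ^ 2 + ‖x 1‖ ^ 2 - ‖x 2‖ ^ 2 := by
  simp only [herm, Complex.mul_conj, ← Complex.sq_norm]
  norm_cast

/-- The vector representing `herm · y` with respect to the dot product. -/
def hermDual (y : V3) : V3 := ![conj (y 0), conj (y 1), -conj (y 2)]

theorem dotProduct_hermDual (x y : V3) : x ⬝ᵥ hermDual y = herm x y := by
  simp [hermDual, herm, dotProduct, Fin.sum_univ_three]; ring

theorem hermDual_hermDual (y : V3) : hermDual (hermDual y) = y := by
  ext i; fin_cases i <;> simp [hermDual]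

theorem hermDual_smul (c : ℂ) (y : V3) : hermDual (c • y) = conj c • hermDual y := by
  ext i; fin_cases i <;> simp [hermDual]

theorem hermDual_zero : hermDual 0 = 0 := by
  ext i; fin_cases i <;> simp [hermDual]

/-- A nonzero vector orthogonal to a negative vector is positive. -/
theorem herm_self_re_pos_of_orthogonal {u v : V3} (hv : (herm v v).re < 0)
    (huv : herm u v = 0) (hu : u ≠ 0) : 0 < (herm u u).re := by
  rw [herm_self_re] at hv ⊢
  have h2 : ‖u 2‖ * ‖v 2‖ ≤ ‖u 0‖ * ‖v 0‖ + ‖u 1‖ * ‖v 1‖ := by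
    have h : u 2 * conj (v 2) = u 0 * conj (v 0) + u 1 * conj (v 1) := by
      unfold herm at huv; linear_combination -huv
    have h' := norm_add_le (u 0 * conj (v 0)) (u 1 * conj (v 1))
    rw [← h] at h'
    simpa only [norm_mul, RCLike.norm_conj] using h'
  have hsq : (‖u 2‖ * ‖v 2‖) ^ 2 ≤ (‖u 0‖ ^ 2 + ‖u 1‖ ^ 2) * (‖v 0‖ ^ 2 + ‖v 1‖ ^ 2) := by
    have h3 := pow_le_pow_left₀ (by positivity) h2 2
    nlinarith [sq_nonneg (‖u 0‖ * ‖v 1‖ - ‖u 1‖ * ‖v 0‖)]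
  have hv2 : 0 < ‖v 2‖ ^ 2 := by nlinarith [sq_nonneg ‖v 0‖, sq_nonneg ‖v 1‖]
  by_contra! hle
  have h01 : ‖u 0‖ ^ 2 + ‖u 1‖ ^ 2 = 0 := by
    by_contra hne
    have hpos : 0 < ‖u 0‖ ^ 2 + ‖u 1‖ ^ 2 := lt_of_le_of_ne (by positivity) (Ne.symm hne)
    nlinarith
  have h22 : ‖u 2‖ ^ 2 = 0 := by
    rw [h01, zero_mul, mul_pow] at hsq
    nlinarith [sq_nonneg ‖u 2‖]
  have h00 : ‖u 0‖ ^ 2 = 0 := by nlinarith [sq_nonneg ‖u 0‖, sq_nonneg ‖u 1‖]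
  have h11 : ‖u 1‖ ^ 2 = 0 := by nlinarith [sq_nonneg ‖u 0‖, sq_nonneg ‖u 1‖]
  apply hu
  ext i
  fin_cases i
  · simpa using h00
  · simpa using h11
  · simpa using h22

theorem linearIndependent_pair_of_nonneg_of_neg {f v : V3} (hf : f ≠ 0)
    (hfs : 0 ≤ (herm f f).re) (hv : v ≠ 0) (hvs : (herm v v).re < 0) :
    LinearIndependent ℂ ![v, f] := by
  rw [LinearIndependent.pair_iff' hv]
  rintro a rfl
  have h : (herm (a • v) (a • v)).re = ‖a‖ ^ 2 * (herm v v).re := by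
    simp only [herm_self_re, Pi.smul_apply, smul_eq_mul, norm_mul]; ring
  have ha : 0 < ‖a‖ ^ 2 := by
    have : a ≠ 0 := by rintro rfl; simp at hf
    positivity
  nlinarith

theorem hermDual_cross_ne_zero {v f : V3} (h : LinearIndependent ℂ ![v, f]) :
    crossProduct (hermDual v) (hermDual f) ≠ 0 := by
  have hv : v ≠ 0 := h.ne_zero 0
  have hv' : hermDual v ≠ 0 := fun h0 => hv (by rw [← hermDual_hermDual v, h0, hermDual_zero])
  rw [crossProduct_ne_zero_iff_linearIndependent, LinearIndependent.pair_iff' hv']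
  intro a ha
  rw [LinearIndependent.pair_iff' hv] at h
  apply h (conj a)
  rw [← hermDual_hermDual f, ← ha, hermDual_smul, hermDual_hermDual]

/-- The orthogonal complement of two independent vectors is spanned by a cross product. -/
theorem exists_smul_cross_of_orthogonal {v f x : V3} (h : LinearIndependent ℂ ![v, f])
    (hxv : herm x v = 0) (hxf : herm x f = 0) :
    ∃ c : ℂ, c • crossProduct (hermDual v) (hermDual f) = x := by
  have hne := hermDual_cross_ne_zero h
  have h0 : crossProduct (crossProduct (hermDual v) (hermDual f)) x = 0 := by
    rw [cross_cross_eq_smul_sub_smul, dotProduct_comm, dotProduct_comm (hermDual f),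
      dotProduct_hermDual, dotProduct_hermDual, hxv, hxf]
    simp
  by_contra! hc
  exact crossProduct_ne_zero_iff_linearIndependent.2 ((LinearIndependent.pair_iff' hne).2 hc) h0

/-- A traceless endomorphism with two independent kernel vectors and an eigenvector independent
of them vanishes. -/
theorem eq_zero_of_trace_eq_zero {h : Module.End ℂ V3} {b : Fin 3 → V3}
    (hb : LinearIndependent ℂ b) (h0 : h (b 0) = 0) (h1 : h (b 1) = 0) {c : ℂ}
    (h2 : h (b 2) = c • b 2) (htr : LinearMap.trace ℂ V3 h = 0) : h = 0 := by
  let B := basisOfLinearIndependentOfCardEqFinrank hb (by simp)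
  have hB : ∀ i, B i = b i := fun i => by simp [B]
  rw [← hB] at h0 h1
  rw [← hB] at h2
  have hc : c = 0 := by
    rw [LinearMap.trace_eq_matrix_trace ℂ B, Matrix.trace, Fin.sum_univ_three] at htr
    simpa only [Matrix.diag_apply, LinearMap.toMatrix_apply, h0, h1, h2, map_zero, map_smul,
      Finsupp.zero_apply, Finsupp.smul_apply, Module.Basis.repr_self, Finsupp.single_eq_same,
      smul_eq_mul, mul_one, zero_add] using htr
  rw [hc, zero_smul] at h2
  refine B.ext fun i => ?_
  fin_cases i
  exacts [h0, h1, h2]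

/-- Remark 4.3.3: a confocal linear family of bisectors whose common
focus is not negative has real dimension at most `2`. -/
theorem stmt_10 (W : Submodule ℝ (Module.End ℂ V3)) (hW : IsLinearFamily W)
    (f₀ : V3) (hf0 : f₀ ≠ 0) (hsig : 0 ≤ (herm f₀ f₀).re)
    (hconf : ∀ h ∈ W, h f₀ = 0) :
    Module.finrank ℝ W ≤ 2 := by
  obtain ⟨hh, v, hv0, hvneg, hbase⟩ := hW
  have hli := linearIndependent_pair_of_nonneg_of_neg hf0 hsig hv0 hvneg
  set u : V3 := crossProduct (hermDual v) (hermDual f₀) with hu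
  have hu0 : u ≠ 0 := hermDual_cross_ne_zero hli
  have huv : herm u v = 0 := by
    rw [← dotProduct_hermDual, dotProduct_comm, hu, dot_self_cross]
  have huf : herm u f₀ = 0 := by
    rw [← dotProduct_hermDual, dotProduct_comm, hu, dot_cross_self]
  have huu : herm u u ≠ 0 := fun h0 => by
    have := herm_self_re_pos_of_orthogonal hvneg huv hu0
    simp [h0] at this
  have hvu : herm v u = 0 := by rw [← herm_conj_symm, huv, map_zero]
  have hfu : herm f₀ u = 0 := by rw [← herm_conj_symm, huf, map_zero]
  have hli3 : LinearIndependent ℂ ![v, f₀, u] := by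
    rw [Fintype.linearIndependent_iff]
    intro g hg
    simp only [Fin.sum_univ_three, Matrix.cons_val] at hg
    have h2 : g 2 = 0 := by
      have := congrArg (herm · u) hg
      simpa [herm_add_left, herm_smul_left, hvu, hfu, herm_zero_left, huu] using this
    rw [h2, zero_smul, add_zero] at hg
    obtain ⟨h0, h1⟩ := LinearIndependent.pair_iff.1 hli _ _ hg
    intro i
    fin_cases i
    exacts [h0, h1, h2]
  let φ : W →ₗ[ℝ] ℂ :=
    { toFun := fun h => herm (h.1 v) u
      map_add' := fun h k => by
        simp [herm_add_left]
      map_smul' := fun r h => by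
        have : ((r • h : W) : Module.End ℂ V3) v = (r : ℂ) • h.1 v := by
          ext i; simp
        rw [this, herm_smul_left]
        simp }
  have hφ : Function.Injective φ := by
    rw [injective_iff_map_eq_zero]
    rintro ⟨h, hhW⟩ hφh
    obtain ⟨hsa, htr, -⟩ := hh h hhW
    have hperp : ∀ x, herm (h x) f₀ = 0 := fun x => by
      rw [hsa, hconf h hhW, herm_zero_right]
    obtain ⟨c, hc⟩ := exists_smul_cross_of_orthogonal hli (hbase h hhW) (hperp v)
    have hhv : h v = 0 := by
      have h1 : herm (h v) u = 0 := hφh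
      rw [← hc, ← hu, herm_smul_left] at h1
      rw [← hc, (mul_eq_zero.1 h1).resolve_right huu, zero_smul]
    obtain ⟨d, hd⟩ := exists_smul_cross_of_orthogonal hli
      (show herm (h u) v = 0 by rw [hsa, hhv, herm_zero_right]) (hperp u)
    exact Subtype.ext (eq_zero_of_trace_eq_zero hli3 hhv (hconf h hhW) hd.symm htr)
  simpa [Complex.finrank_real_complex] using LinearMap.finrank_le_finrank_of_injective hφ

end
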